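/- arXiv:1709.03930 — 4 statements merged into one kernel-verified Lean document; each statement's English description precedes it below -/
import Mathlib

section
/- Let T > 0 and let v : ℝ × [0,T] → ℝ be continuous, bounded, and Lipschitz in the space variable with constant L uniformly in time; let Φ be a flow map of v, i.e. Φ_0(x) = x and (d/dt) Φ_t(x) = v(Φ_t(x), t) for all t ∈ [0,T] and x ∈ ℝ. Let μ₀ be a finite nonnegative Borel measure on ℝ and set m_t := (Φ_t)_# μ₀. Then for every C¹ function f : ℝ × [0,T] → ℝ with compact support, ∫ f(x, T) dm_T(x) − ∫ f(x, 0) dμ₀(x) = ∫₀^T ∫ ( ∂_t f(x, t) + v(x, t) ∂_x f(x, t) ) dm_t(x) dt; that is, the pushforward family (m_t) is a measure-valued solution of the transport equation ∂_t m + ∂_x(v m) = 0 with initial datum μ₀. -/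
open MeasureTheory Set

/-- The bounded-Lipschitz norm of a function: sup of |φ| plus the least Lipschitz constant. -/
noncomputable def blNorm {X : Type*} [PseudoMetricSpace X] (φ : X → ℝ) : ℝ :=
  (⨆ x, |φ x|) + sInf {K : ℝ | 0 ≤ K ∧ LipschitzWith K.toNNReal φ}

/-- A function is bounded Lipschitz. -/
def IsBoundedLipschitz {X : Type*} [PseudoMetricSpace X] (φ : X → ℝ) : Prop :=
  (∃ C, ∀ x, |φ x| ≤ C) ∧ ∃ K, LipschitzWith K φ

/-- The bounded-Lipschitz (flat) dual distance between two measures: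
`‖μ − ν‖*_BL = sup {|∫ φ dμ − ∫ φ dν| : φ bounded Lipschitz, ‖φ‖_BL ≤ 1}`. -/
noncomputable def blDist {X : Type*} [PseudoMetricSpace X] [MeasurableSpace X]
    (μ ν : Measure X) : ℝ :=
  sSup {r : ℝ | ∃ φ : X → ℝ, IsBoundedLipschitz φ ∧ blNorm φ ≤ 1 ∧
    r = |(∫ x, φ x ∂μ) - ∫ x, φ x ∂ν|}

/-- The total derivative of a `C¹` function along a trajectory of a time-dependent vector field. -/
theorem hasDerivAt_along_trajectory {f : ℝ × ℝ → ℝ} (hf : Differentiable ℝ f)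
    {γ : ℝ → ℝ} {w t : ℝ} (hγ : HasDerivAt γ w t) :
    HasDerivAt (fun s => f (γ s, s))
      (fderiv ℝ f (γ t, t) (0, 1) + w * fderiv ℝ f (γ t, t) (1, 0)) t := by
  have h := (hf (γ t, t)).hasFDerivAt.comp_hasDerivAt (f := fun s => (γ s, s)) t
    (hγ.prodMk (hasDerivAt_id' t))
  have hw : ((w, 1) : ℝ × ℝ) = (0, 1) + w • (1, 0) := by simp
  rw [hw, map_add, map_smul, smul_eq_mul] at h
  exact h

/-- A map that is measurable in space and continuous in time on `[0, T]` becomes jointly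
measurable once time is clamped to `[0, T]`. -/
theorem measurable_uncurry_projIcc {T : ℝ} (hT : 0 ≤ T) {Φ : ℝ → ℝ → ℝ}
    (hc : ∀ x, ContinuousOn (fun t => Φ t x) (Set.Icc 0 T)) (hm : ∀ t, Measurable (Φ t)) :
    Measurable fun p : ℝ × ℝ => Φ (Set.projIcc 0 T hT p.1) p.2 := by
  refine measurable_uncurry_of_continuous_of_measurable
    (u := fun t x => Φ (Set.projIcc 0 T hT t) x) (fun x => ?_) fun t => hm _
  exact (hc x).comp_continuous (continuous_subtype_val.comp continuous_projIcc) fun t =>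
    (Set.projIcc 0 T hT t).2

/-- The pushforward of the initial datum along the flow of a continuous,
bounded, space-Lipschitz time-dependent velocity field is a measure-valued solution of
the transport equation ∂ₜ m + ∂ₓ(v m) = 0. -/
theorem pushforward_is_weak_solution (T : ℝ) (hT : 0 < T)
    (v : ℝ → ℝ → ℝ) (L : ℝ)
    (hvc : Continuous fun p : ℝ × ℝ => v p.1 p.2)
    (hvb : ∃ C, ∀ x t, |v x t| ≤ C)
    (hvL : ∀ t ∈ Set.Icc 0 T, ∀ x y, |v x t - v y t| ≤ L * |x - y|)
    (Φ : ℝ → ℝ → ℝ) (hΦ0 : ∀ x, Φ 0 x = x)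
    (hΦ : ∀ x, ∀ t ∈ Set.Icc 0 T, HasDerivAt (fun τ => Φ τ x) (v (Φ t x) t) t)
    (hΦm : ∀ t, Measurable (Φ t))
    (μ₀ : Measure ℝ) [IsFiniteMeasure μ₀]
    (m : ℝ → Measure ℝ) (hm : ∀ t, m t = Measure.map (Φ t) μ₀)
    (f : ℝ × ℝ → ℝ) (hf : ContDiff ℝ 1 f) (hfc : HasCompactSupport f) :
    (∫ x, f (x, T) ∂(m T)) - (∫ x, f (x, 0) ∂μ₀) =
      ∫ t in (0:ℝ)..T, ∫ x,
        (fderiv ℝ f (x, t) (0, 1) + v x t * fderiv ℝ f (x, t) (1, 0)) ∂(m t) := by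
  set g : ℝ × ℝ → ℝ := fun p =>
    fderiv ℝ f p (0, 1) + v p.1 p.2 * fderiv ℝ f p (1, 0) with hg
  have hdf : Continuous (fderiv ℝ f) := hf.continuous_fderiv one_ne_zero
  have hgc : Continuous g :=
    (hdf.clm_apply continuous_const).add (hvc.mul (hdf.clm_apply continuous_const))
  have hgs : HasCompactSupport g :=
    (hfc.fderiv_apply (𝕜 := ℝ) (0, 1)).add (hfc.fderiv_apply (𝕜 := ℝ) (1, 0)).mul_left
  obtain ⟨Cf, hCf⟩ := hfc.exists_bound_of_continuous hf.continuous
  obtain ⟨Cg, hCg⟩ := hgs.exists_bound_of_continuous hgc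
  have hΦc : ∀ x, ContinuousOn (fun t => Φ t x) (Set.Icc 0 T) := fun x t ht =>
    (hΦ x t ht).continuousAt.continuousWithinAt
  have hfi : ∀ t, Integrable (fun x => f (Φ t x, t)) μ₀ := fun t =>
    .of_bound (hf.continuous.measurable.comp
      ((hΦm t).prodMk measurable_const)).aestronglyMeasurable Cf (.of_forall fun x => hCf _)
  have hpush : ∀ {h : ℝ × ℝ → ℝ}, Continuous h → ∀ t,
      ∫ x, h (x, t) ∂(m t) = ∫ x, h (Φ t x, t) ∂μ₀ := fun {h} hh t => by
    rw [hm t]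
    exact integral_map (hΦm t).aemeasurable
      (hh.comp (continuous_id.prodMk continuous_const)).aestronglyMeasurable
  have hftc : ∀ x, f (Φ T x, T) - f (Φ 0 x, 0) = ∫ t in (0:ℝ)..T, g (Φ t x, t) := fun x => by
    refine (intervalIntegral.integral_eq_sub_of_hasDerivAt (f := fun t => f (Φ t x, t))
      (fun t ht => ?_) (ContinuousOn.intervalIntegrable ?_)).symm
    · rw [Set.uIcc_of_le hT.le] at ht
      exact hasDerivAt_along_trajectory (hf.differentiable one_ne_zero) (hΦ x t ht)
    · rw [Set.uIcc_of_le hT.le]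
      exact hgc.comp_continuousOn ((hΦc x).prodMk continuousOn_id)
  have hint : Integrable (Function.uncurry fun t x => g (Φ t x, t))
      ((volume.restrict (Set.uIoc 0 T)).prod μ₀) := by
    rw [Set.uIoc_of_le hT.le]
    have hmeas : Measurable fun p : ℝ × ℝ => g (Φ (Set.projIcc 0 T hT.le p.1) p.2, p.1) :=
      hgc.measurable.comp ((measurable_uncurry_projIcc hT.le hΦc hΦm).prodMk measurable_fst)
    refine .of_bound (hmeas.aestronglyMeasurable.congr ?_) Cg (.of_forall fun p => hCg _)
    have hmem : ∀ᵐ t ∂(volume.restrict (Set.Ioc 0 T)), t ∈ Set.Ioc 0 T :=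
      ae_restrict_mem measurableSet_Ioc
    filter_upwards [Measure.quasiMeasurePreserving_fst.ae hmem] with p hp
    simp [Function.uncurry, Set.projIcc_of_mem hT.le (Set.Ioc_subset_Icc_self hp)]
  calc (∫ x, f (x, T) ∂(m T)) - (∫ x, f (x, 0) ∂μ₀)
      = ∫ x, (f (Φ T x, T) - f (Φ 0 x, 0)) ∂μ₀ := by
        rw [integral_sub (hfi T) (hfi 0), hpush hf.continuous]
        simp only [hΦ0]
    _ = ∫ x, (∫ t in (0:ℝ)..T, g (Φ t x, t)) ∂μ₀ := by simp only [hftc]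
    _ = ∫ t in (0:ℝ)..T, ∫ x, g (Φ t x, t) ∂μ₀ :=
        (intervalIntegral_integral_swap hint).symm
    _ = ∫ t in (0:ℝ)..T, ∫ x, g (x, t) ∂(m t) := by simp only [hpush hgc]
end

section
/- Let T > 0, let v : ℝ → ℝ be Lipschitz with 0 ≤ v(x) ≤ V_max for all x, and let Φ be its flow map. Let μ₀ be a finite nonnegative Borel measure on ℝ supported in [0, ∞) and let σ₀ be a finite nonnegative Borel measure on [0, T] (the boundary/source measure at the vertex x = 0). For t ∈ [0, T] define m_t := (Φ_t)_# μ₀ + (s ↦ Φ_{t−s}(0))_# (σ₀ restricted to [0, t]). Then for every C¹ function f : ℝ × [0,T] → ℝ with compact support, ∫ f(x, T) dm_T(x) − ∫ f(x, 0) dμ₀(x) − ∫_{[0,T]} f(0, s) dσ₀(s) = ∫₀^T ∫ ( ∂_t f(x, t) + v(x) ∂_x f(x, t) ) dm_t(x) dt; that is, the push-forward of the initial and boundary data along the flow is a measure-valued solution of the transport equation on the half-line [0, ∞) with source measure σ₀ at the origin. -/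
open MeasureTheory Set

/-- The transport derivative `∂ₜ f + v ∂ₓ f` along a bounded continuous velocity field of a
compactly supported `C¹` function is continuous and bounded. -/
lemma transportDeriv_continuous_bounded {v : ℝ → ℝ} (hvc : Continuous v) {C : ℝ}
    (hvb : ∀ x, |v x| ≤ C) {f : ℝ × ℝ → ℝ} (hf : ContDiff ℝ 1 f) (hfc : HasCompactSupport f) :
    Continuous (fun p : ℝ × ℝ => fderiv ℝ f p (0, 1) + v p.1 * fderiv ℝ f p (1, 0)) ∧
    ∃ B, ∀ p : ℝ × ℝ, ‖fderiv ℝ f p (0, 1) + v p.1 * fderiv ℝ f p (1, 0)‖ ≤ B := by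
  have hc : Continuous (fderiv ℝ f) := hf.continuous_fderiv one_ne_zero
  obtain ⟨D, hD⟩ := hc.bounded_above_of_compact_support (hfc.fderiv ℝ)
  refine ⟨by fun_prop, D + C * D, fun p => ?_⟩
  have h (w : ℝ × ℝ) (hw : ‖w‖ = 1) : ‖fderiv ℝ f p w‖ ≤ D :=
    ((fderiv ℝ f p).le_opNorm w).trans (by rw [hw, mul_one]; exact hD p)
  refine (norm_add_le _ _).trans (add_le_add (h _ (by simp [Prod.norm_def])) ?_)
  rw [norm_mul]
  exact mul_le_mul (hvb _) (h _ (by simp [Prod.norm_def])) (norm_nonneg _)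
    ((abs_nonneg _).trans (hvb p.1))

/-- Superposition principle for trajectories `t ↦ X t s` that enter at time `τ s`. -/
lemma integral_transportDeriv_along_trajectories {T : ℝ} (hT : 0 ≤ T) {v : ℝ → ℝ}
    (hvc : Continuous v) {C : ℝ} (hvb : ∀ x, |v x| ≤ C)
    {f : ℝ × ℝ → ℝ} (hf : ContDiff ℝ 1 f) (hfc : HasCompactSupport f)
    {α : Type*} [MeasurableSpace α] (ν : Measure α) [IsFiniteMeasure ν]
    {τ : α → ℝ} (hτm : Measurable τ) (hτ : ∀ᵐ s ∂ν, τ s ∈ Icc 0 T)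
    {X : ℝ → α → ℝ} (hXm : ∀ t, Measurable (X t))
    (hX : ∀ s t, HasDerivAt (fun t => X t s) (v (X t s)) t) :
    IntervalIntegrable (fun t => ∫ s in {s | τ s ≤ t},
      (fderiv ℝ f (X t s, t) (0, 1) + v (X t s) * fderiv ℝ f (X t s, t) (1, 0)) ∂ν)
      volume 0 T ∧
    ∫ t in (0 : ℝ)..T, (∫ s in {s | τ s ≤ t},
      (fderiv ℝ f (X t s, t) (0, 1) + v (X t s) * fderiv ℝ f (X t s, t) (1, 0)) ∂ν) =
      (∫ s, f (X T s, T) ∂ν) - ∫ s, f (X (τ s) s, τ s) ∂ν := by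
  obtain ⟨hgc, B, hB⟩ := transportDeriv_continuous_bounded hvc hvb hf hfc
  set g : ℝ × ℝ → ℝ := fun p => fderiv ℝ f p (0, 1) + v p.1 * fderiv ℝ f p (1, 0)
  have hXc (s : α) : Continuous fun t => X t s :=
    continuous_iff_continuousAt.2 fun t => (hX s t).continuousAt
  have hXj : Measurable (Function.uncurry X) :=
    measurable_uncurry_of_continuous_of_measurable (u := X) hXc hXm
  have hms (t : ℝ) : MeasurableSet {s | τ s ≤ t} := measurableSet_le hτm measurable_const
  let G : ℝ → α → ℝ := fun t => {s | τ s ≤ t}.indicator fun s => g (X t s, t)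
  have hGm : Measurable (Function.uncurry G) := by
    have h1 : MeasurableSet {p : ℝ × α | τ p.2 ≤ p.1} :=
      measurableSet_le (hτm.comp measurable_snd) measurable_fst
    exact (hgc.measurable.comp (hXj.prodMk measurable_fst)).indicator h1
  have hGi : Integrable (Function.uncurry G) ((volume.restrict (Ioc 0 T)).prod ν) := by
    refine Integrable.of_bound hGm.aestronglyMeasurable B (ae_of_all _ fun p => ?_)
    exact (norm_indicator_le_norm_self (fun s => g (X p.1 s, p.1)) p.2).trans (hB (X p.1 p.2, p.1))
  have hGe (t : ℝ) : ∫ s in {s | τ s ≤ t}, g (X t s, t) ∂ν = ∫ s, G t s ∂ν :=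
    (integral_indicator (hms t)).symm
  obtain ⟨A, hA⟩ := hf.continuous.bounded_above_of_compact_support hfc
  change IntervalIntegrable (fun t => ∫ s in {s | τ s ≤ t}, g (X t s, t) ∂ν) volume 0 T ∧
    ∫ t in (0 : ℝ)..T, (∫ s in {s | τ s ≤ t}, g (X t s, t) ∂ν) = _
  simp_rw [hGe]
  refine ⟨(intervalIntegrable_iff_integrableOn_Ioc_of_le hT).2 hGi.integral_prod_left, ?_⟩
  have hi1 : Integrable (fun s => f (X T s, T)) ν :=
    Integrable.of_bound (hf.continuous.measurable.comp
      ((hXm T).prodMk measurable_const)).aestronglyMeasurable A (ae_of_all _ fun s => hA _)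
  have hi2 : Integrable (fun s => f (X (τ s) s, τ s)) ν :=
    Integrable.of_bound (hf.continuous.measurable.comp
      ((hXj.comp (hτm.prodMk measurable_id)).prodMk hτm)).aestronglyMeasurable A
      (ae_of_all _ fun s => hA _)
  rw [intervalIntegral.integral_of_le hT, integral_integral_swap hGi, ← integral_sub hi1 hi2]
  refine integral_congr_ae ?_
  filter_upwards [hτ] with s hs
  have hd (t : ℝ) : HasDerivAt (fun t => f (X t s, t)) (g (X t s, t)) t := by
    have hp : HasDerivAt (fun t => (X t s, t)) (v (X t s), 1) t :=
      (hX s t).prodMk (hasDerivAt_id t)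
    have h := ((hf.differentiable one_ne_zero (X t s, t)).hasFDerivAt).comp_hasDerivAt
      (f := fun t => (X t s, t)) t hp
    have e : g (X t s, t) = fderiv ℝ f (X t s, t) (v (X t s), 1) := by
      have : ((v (X t s), 1) : ℝ × ℝ) = (0, 1) + v (X t s) • (1, 0) := by simp
      rw [this, map_add, map_smul, smul_eq_mul]
    rw [e]
    exact h
  have hsG : (fun t => G t s) = (Ici (τ s)).indicator fun t => g (X t s, t) := by
    ext t
    simp [G, indicator_apply]
  rw [hsG, setIntegral_indicator measurableSet_Ici]
  have hae : (Ioc 0 T ∩ Ici (τ s) : Set ℝ) =ᵐ[volume] Ioc (τ s) T := by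
    have h1 : (Ioc 0 T ∩ Ici (τ s) : Set ℝ) =ᵐ[volume] (Ioc 0 T ∩ Ioi (τ s) : Set ℝ) :=
      (Filter.EventuallyEq.refl _ _).inter Ioi_ae_eq_Ici.symm
    rwa [Ioc_inter_Ioi, sup_eq_right.2 hs.1] at h1
  rw [setIntegral_congr_set hae, ← intervalIntegral.integral_of_le hs.2]
  exact intervalIntegral.integral_eq_sub_of_hasDerivAt (fun t _ => hd t)
    ((hgc.comp ((hXc s).prodMk continuous_id)).intervalIntegrable _ _)

/-- On the half-line with a source measure σ₀ at the origin, the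
push-forward of the initial and boundary data along the flow is a measure-valued
solution of the transport equation. -/
theorem halfline_source_weak_solution (T : ℝ) (hT : 0 < T)
    (v : ℝ → ℝ) (K : NNReal) (hv : LipschitzWith K v)
    (Vmax : ℝ) (hv0 : ∀ x, 0 ≤ v x) (hvb : ∀ x, v x ≤ Vmax)
    (Φ : ℝ → ℝ → ℝ) (hΦ0 : ∀ x, Φ 0 x = x)
    (hΦ : ∀ x t, HasDerivAt (fun τ => Φ τ x) (v (Φ t x)) t)
    (hΦm : ∀ t, Measurable (Φ t))
    (hΦm2 : ∀ t : ℝ, Measurable fun s : ℝ => Φ (t - s) 0)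
    (μ₀ : Measure ℝ) [IsFiniteMeasure μ₀] (hμ₀ : μ₀ (Set.Iio 0) = 0)
    (σ₀ : Measure ℝ) [IsFiniteMeasure σ₀] (hσ₀ : σ₀ (Set.Icc 0 T)ᶜ = 0)
    (m : ℝ → Measure ℝ)
    (hm : ∀ t, m t = Measure.map (Φ t) μ₀ +
      Measure.map (fun s => Φ (t - s) 0) (σ₀.restrict (Set.Icc 0 t)))
    (f : ℝ × ℝ → ℝ) (hf : ContDiff ℝ 1 f) (hfc : HasCompactSupport f) :
    (∫ x, f (x, T) ∂(m T)) - (∫ x, f (x, 0) ∂μ₀) - (∫ s, f (0, s) ∂σ₀) =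
      ∫ t in (0:ℝ)..T, ∫ x,
        (fderiv ℝ f (x, t) (0, 1) + v x * fderiv ℝ f (x, t) (1, 0)) ∂(m t) := by
  have hvabs (x : ℝ) : |v x| ≤ Vmax := by rw [abs_of_nonneg (hv0 x)]; exact hvb x
  obtain ⟨hgc, B, hB⟩ := transportDeriv_continuous_bounded hv.continuous hvabs hf hfc
  obtain ⟨A, hA⟩ := hf.continuous.bounded_above_of_compact_support hfc
  have hsplit (t : ℝ) {h : ℝ → ℝ} (hh : Continuous h) {b : ℝ} (hb : ∀ x, ‖h x‖ ≤ b) :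
      ∫ x, h x ∂(m t) = (∫ x, h (Φ t x) ∂μ₀) + ∫ s in Icc 0 t, h (Φ (t - s) 0) ∂σ₀ := by
    rw [hm t, integral_add_measure
      (Integrable.of_bound hh.aestronglyMeasurable b (ae_of_all _ hb))
      (Integrable.of_bound hh.aestronglyMeasurable b (ae_of_all _ hb)),
      integral_map (hΦm t).aemeasurable hh.aestronglyMeasurable,
      integral_map (hΦm2 t).aemeasurable hh.aestronglyMeasurable]
  have hσ : ∀ᵐ s ∂σ₀, s ∈ Icc 0 T := hσ₀
  have hσr (t : ℝ) : σ₀.restrict (Icc 0 t) = σ₀.restrict {s | s ≤ t} := by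
    refine Measure.restrict_congr_set ?_
    filter_upwards [hσ] with s hs
    exact propext ⟨fun h => h.2, fun h => ⟨hs.1, h⟩⟩
  obtain ⟨hi1, he1⟩ := integral_transportDeriv_along_trajectories hT.le hv.continuous hvabs hf hfc
    μ₀ (τ := fun _ => 0) measurable_const (ae_of_all _ fun _ => ⟨le_rfl, hT.le⟩) hΦm hΦ
  obtain ⟨hi2, he2⟩ := integral_transportDeriv_along_trajectories hT.le hv.continuous hvabs hf hfc
    σ₀ (τ := fun s => s) measurable_id hσ (X := fun t s => Φ (t - s) 0) hΦm2
    (fun s t => (hΦ 0 (t - s)).comp_sub_const t s)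
  have hrhs : ∫ t in (0:ℝ)..T, ∫ x,
      (fderiv ℝ f (x, t) (0, 1) + v x * fderiv ℝ f (x, t) (1, 0)) ∂(m t) =
      ∫ t in (0:ℝ)..T, ((∫ s in {_s : ℝ | (0 : ℝ) ≤ t}, (fderiv ℝ f (Φ t s, t) (0, 1) +
        v (Φ t s) * fderiv ℝ f (Φ t s, t) (1, 0)) ∂μ₀) +
        ∫ s in {s | s ≤ t}, (fderiv ℝ f (Φ (t - s) 0, t) (0, 1) +
        v (Φ (t - s) 0) * fderiv ℝ f (Φ (t - s) 0, t) (1, 0)) ∂σ₀) := by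
    refine intervalIntegral.integral_congr fun t ht => ?_
    rw [uIcc_of_le hT.le] at ht
    have hu : {_s : ℝ | (0 : ℝ) ≤ t} = univ := eq_univ_of_forall fun _ => ht.1
    have h := hsplit t (hgc.comp (continuous_id.prodMk continuous_const)) fun x => hB (x, t)
    simp only [hu, Measure.restrict_univ, ← hσr]
    exact h
  have hT' := hsplit T (hf.continuous.comp (continuous_id.prodMk continuous_const))
    fun x => hA (x, T)
  simp only [Function.comp_apply, id_eq] at hT'
  have hσT : σ₀.restrict (Icc 0 T) = σ₀ := Measure.restrict_eq_self_of_ae_mem hσ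
  rw [hrhs, intervalIntegral.integral_add hi1 hi2, he1, he2, hT', hσT]
  simp only [hΦ0, sub_self]
  ring
end

section
/- In the setting of the half-line solution with source, i.e. m_t := (Φ_t)_# μ₀ + (s ↦ Φ_{t−s}(0))_# (σ₀ restricted to [0, t]) where Φ is the flow of a Lipschitz field v with 0 ≤ v ≤ V_max, μ₀ is a finite nonnegative Borel measure on ℝ and σ₀ a finite nonnegative Borel measure on [0,T], for all 0 ≤ s ≤ t ≤ T one has the time-regularity estimate ‖m_t − m_s‖*_BL ≤ σ₀((s, t]) + V_max ( μ₀(ℝ) + σ₀([0, T]) ) (t − s). -/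
open MeasureTheory Set

theorem IsBoundedLipschitz.abs_le_blNorm {X : Type*} [PseudoMetricSpace X] {φ : X → ℝ}
    (hφ : IsBoundedLipschitz φ) (x : X) : |φ x| ≤ blNorm φ := by
  obtain ⟨⟨C, hC⟩, -⟩ := hφ
  have hx : |φ x| ≤ ⨆ x, |φ x| :=
    le_ciSup (f := fun x => |φ x|) ⟨C, by rintro _ ⟨y, rfl⟩; exact hC y⟩ x
  exact hx.trans (le_add_of_nonneg_right (Real.sInf_nonneg fun _ h => h.1))

theorem IsBoundedLipschitz.abs_sub_le_blNorm_mul_dist {X : Type*} [PseudoMetricSpace X]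
    {φ : X → ℝ} (hφ : IsBoundedLipschitz φ) (x y : X) :
    |φ x - φ y| ≤ blNorm φ * dist x y := by
  obtain ⟨-, L, hL⟩ := hφ
  have hbound : ∀ K : ℝ, 0 ≤ K ∧ LipschitzWith K.toNNReal φ → |φ x - φ y| ≤ K * dist x y := by
    rintro K ⟨hK, hlip⟩
    simpa [Real.dist_eq, hK] using hlip.dist_le_mul x y
  have hne : {K : ℝ | 0 ≤ K ∧ LipschitzWith K.toNNReal φ}.Nonempty :=
    ⟨L, L.coe_nonneg, by simpa using hL⟩
  have hsInf : |φ x - φ y| ≤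
      sInf {K : ℝ | 0 ≤ K ∧ LipschitzWith K.toNNReal φ} * dist x y := by
    rcases (dist_nonneg (x := x) (y := y)).eq_or_lt with h | h
    · obtain ⟨K, hK⟩ := hne
      simpa [← h] using hbound K hK
    · rw [← div_le_iff₀ h]
      exact le_csInf hne fun K hK => (div_le_iff₀ h).2 (hbound K hK)
  refine hsInf.trans ?_
  gcongr
  exact le_add_of_nonneg_left (Real.iSup_nonneg fun _ => abs_nonneg _)

theorem blDist_le {X : Type*} [PseudoMetricSpace X] [MeasurableSpace X] {μ ν : Measure X}
    {B : ℝ} (hB : 0 ≤ B)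
    (h : ∀ φ : X → ℝ, (∀ x, |φ x| ≤ 1) → LipschitzWith 1 φ →
      |(∫ x, φ x ∂μ) - ∫ x, φ x ∂ν| ≤ B) : blDist μ ν ≤ B := by
  refine Real.sSup_le ?_ hB
  rintro _ ⟨φ, hφ, hnorm, rfl⟩
  refine h φ (fun x => (hφ.abs_le_blNorm x).trans hnorm) (LipschitzWith.mk_one fun x y => ?_)
  rw [Real.dist_eq]
  refine (hφ.abs_sub_le_blNorm_mul_dist x y).trans ?_
  exact mul_le_of_le_one_left dist_nonneg hnorm

theorem integrable_comp_of_abs_le_one {α X : Type*} [MeasurableSpace α] {μ : Measure α}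
    [IsFiniteMeasure μ] [MeasurableSpace X] {φ : X → ℝ}
    (hφm : Measurable φ) (hφ : ∀ x, |φ x| ≤ 1) {f : α → X} (hf : Measurable f) :
    Integrable (fun a => φ (f a)) μ :=
  Integrable.of_bound (hφm.comp hf).aestronglyMeasurable 1
    (Filter.Eventually.of_forall fun _ => hφ _)

theorem abs_integral_comp_sub_le {α X : Type*} [MeasurableSpace α] {μ : Measure α}
    [IsFiniteMeasure μ] [PseudoMetricSpace X] [MeasurableSpace X] [BorelSpace X] {φ : X → ℝ}
    (hφ : ∀ x, |φ x| ≤ 1) (hlip : LipschitzWith 1 φ) {f g : α → X} (hf : Measurable f)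
    (hg : Measurable g) {C : ℝ} (hfg : ∀ a, dist (f a) (g a) ≤ C) :
    |(∫ a, φ (f a) ∂μ) - ∫ a, φ (g a) ∂μ| ≤ C * μ.real univ := by
  have hφm := hlip.continuous.measurable
  rw [← integral_sub (integrable_comp_of_abs_le_one hφm hφ hf)
    (integrable_comp_of_abs_le_one hφm hφ hg), ← Real.norm_eq_abs]
  refine norm_integral_le_of_norm_le_const (Filter.Eventually.of_forall fun a => ?_)
  rw [← dist_eq_norm]
  exact ((hlip.dist_le_mul _ _).trans (by simp)).trans (hfg a)

theorem dist_flow_le {v : ℝ → ℝ} {Vmax : ℝ} (hv0 : ∀ x, 0 ≤ v x) (hvb : ∀ x, v x ≤ Vmax)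
    {Φ : ℝ → ℝ → ℝ} (hΦ : ∀ x t, HasDerivAt (fun τ => Φ τ x) (v (Φ t x)) t) (x a b : ℝ) :
    dist (Φ a x) (Φ b x) ≤ Vmax * |a - b| := by
  rw [dist_eq_norm]
  exact convex_univ.norm_image_sub_le_of_norm_hasDerivWithin_le (f := fun τ => Φ τ x)
    (fun τ _ => (hΦ x τ).hasDerivWithinAt)
    (fun τ _ => by rw [Real.norm_eq_abs, abs_of_nonneg (hv0 _)]; exact hvb _)
    (mem_univ b) (mem_univ a)

/-- Time-regularity estimate for the half-line solution with source:
‖m_t − m_s‖*_BL ≤ σ₀((s,t]) + V_max (μ₀(ℝ) + σ₀([0,T])) (t − s). -/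
theorem halfline_source_time_regularity (T : ℝ) (hT : 0 < T)
    (v : ℝ → ℝ) (K : NNReal) (hv : LipschitzWith K v)
    (Vmax : ℝ) (hv0 : ∀ x, 0 ≤ v x) (hvb : ∀ x, v x ≤ Vmax)
    (Φ : ℝ → ℝ → ℝ) (hΦ0 : ∀ x, Φ 0 x = x)
    (hΦ : ∀ x t, HasDerivAt (fun τ => Φ τ x) (v (Φ t x)) t)
    (hΦm : ∀ t, Measurable (Φ t))
    (hΦm2 : ∀ t : ℝ, Measurable fun s : ℝ => Φ (t - s) 0)
    (μ₀ : Measure ℝ) [IsFiniteMeasure μ₀] (hμ₀ : μ₀ (Set.Iio 0) = 0)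
    (σ₀ : Measure ℝ) [IsFiniteMeasure σ₀] (hσ₀ : σ₀ (Set.Icc 0 T)ᶜ = 0)
    (m : ℝ → Measure ℝ)
    (hm : ∀ t, m t = Measure.map (Φ t) μ₀ +
      Measure.map (fun s => Φ (t - s) 0) (σ₀.restrict (Set.Icc 0 t))) :
    ∀ s t : ℝ, 0 ≤ s → s ≤ t → t ≤ T →
      blDist (m t) (m s) ≤ (σ₀ (Set.Ioc s t)).toReal +
        Vmax * ((μ₀ Set.univ).toReal + (σ₀ (Set.Icc 0 T)).toReal) * (t - s) := by
  intro s t hs hst htT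
  have hV : 0 ≤ Vmax := (hv0 0).trans (hvb 0)
  have hts : 0 ≤ t - s := sub_nonneg.2 hst
  refine blDist_le (by positivity) fun φ hφ hlip => ?_
  have hφm := hlip.continuous.measurable
  have hint : ∀ τ, ∫ x, φ x ∂(m τ) =
      (∫ x, φ (Φ τ x) ∂μ₀) + ∫ r in Icc 0 τ, φ (Φ (τ - r) 0) ∂σ₀ := by
    intro τ
    have hi : ∀ ν : Measure ℝ, IsFiniteMeasure ν → Integrable φ ν := fun ν _ =>
      integrable_comp_of_abs_le_one hφm hφ measurable_id
    rw [hm, integral_add_measure (hi _ inferInstance) (hi _ inferInstance),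
      integral_map (hΦm τ).aemeasurable hφm.aestronglyMeasurable,
      integral_map (hΦm2 τ).aemeasurable hφm.aestronglyMeasurable]
  have hdisj : Disjoint (Icc 0 s) (Ioc s t) :=
    Set.disjoint_left.2 fun x hx hx' => hx'.1.not_ge hx.2
  have hsplit : ∫ r in Icc 0 t, φ (Φ (t - r) 0) ∂σ₀ =
      (∫ r in Icc 0 s, φ (Φ (t - r) 0) ∂σ₀) + ∫ r in Ioc s t, φ (Φ (t - r) 0) ∂σ₀ := by
    rw [← Icc_union_Ioc_eq_Icc hs hst]
    exact setIntegral_union hdisj measurableSet_Ioc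
      (integrable_comp_of_abs_le_one hφm hφ (hΦm2 t))
      (integrable_comp_of_abs_le_one hφm hφ (hΦm2 t))
  have hinitial : |(∫ x, φ (Φ t x) ∂μ₀) - ∫ x, φ (Φ s x) ∂μ₀| ≤
      Vmax * (t - s) * μ₀.real univ :=
    abs_integral_comp_sub_le hφ hlip (hΦm t) (hΦm s) fun x => by
      simpa [abs_of_nonneg hts] using dist_flow_le hv0 hvb hΦ x t s
  have hsource :
      |(∫ r in Icc 0 s, φ (Φ (t - r) 0) ∂σ₀) - ∫ r in Icc 0 s, φ (Φ (s - r) 0) ∂σ₀| ≤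
      Vmax * (t - s) * σ₀.real (Icc 0 T) := by
    refine (abs_integral_comp_sub_le (C := Vmax * (t - s)) hφ hlip (hΦm2 t) (hΦm2 s)
      fun r => ?_).trans ?_
    · simpa [abs_of_nonneg hts] using dist_flow_le hv0 hvb hΦ 0 (t - r) (s - r)
    · rw [measureReal_restrict_apply_univ]
      exact mul_le_mul_of_nonneg_left
        (measureReal_mono (Icc_subset_Icc_right (hst.trans htT))) (by positivity)
  have hnew : |∫ r in Ioc s t, φ (Φ (t - r) 0) ∂σ₀| ≤ σ₀.real (Ioc s t) := by
    simpa using norm_setIntegral_le_of_norm_le_const (C := 1)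
      (f := fun r => φ (Φ (t - r) 0)) (measure_lt_top σ₀ (Ioc s t))
      fun r _ => hφ (Φ (t - r) 0)
  rw [hint, hint, hsplit]
  simp only [← measureReal_def]
  rw [abs_le] at *
  constructor <;> linarith
end

section
/- Let T > 0 and let V be a map assigning to each finite nonnegative Borel measure μ on ℝ a velocity field V(μ) : ℝ → ℝ satisfying: (H1) 0 ≤ V(μ)(x) ≤ V_max for all μ, x; (H2) |V(μ)(x) − V(μ)(y)| ≤ L |x − y| for all μ, x, y; (H3) |V(μ₁)(x) − V(μ₂)(x)| ≤ L ‖μ₁ − μ₂‖*_BL for all x, μ₁, μ₂. Let μ₀ be a finite nonnegative Borel measure on ℝ with finite first and second moments. Then there exists a measure-valued solution of the nonlinear transport equation ∂_t m + ∂_x(V(m_t) m) = 0 on [0,T] with initial datum μ₀: a family (m_t)_{t ∈ [0,T]} of finite nonnegative Borel measures on ℝ, continuous from [0,T] into measures with the bounded-Lipschitz distance, with m_0 = μ₀, such that for every C¹ function f : ℝ × [0,T] → ℝ with compact support, ∫ f(x, T) dm_T(x) − ∫ f(x, 0) dμ₀(x) = ∫₀^T ∫ ( ∂_t f(x, t)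 + V(m_t)(x) ∂_x f(x, t) ) dm_t(x) dt. -/
open MeasureTheory Set

/-- A measure-valued solution of the nonlinear transport equation
`∂ₜ m + ∂ₓ(V(m_t) m) = 0` on `[0,T]` with initial datum `μ₀`: a family of finite
nonnegative Borel measures, continuous in time for the bounded-Lipschitz distance,
starting at `μ₀` and satisfying the weak formulation against all compactly supported
`C¹` test functions. -/
def IsMVSolution (T : ℝ) (V : Measure ℝ → ℝ → ℝ) (μ₀ : Measure ℝ)
    (m : ℝ → Measure ℝ) : Prop :=
  (∀ t ∈ Set.Icc (0:ℝ) T, IsFiniteMeasure (m t)) ∧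
  (∀ t ∈ Set.Icc (0:ℝ) T, ∀ ε > (0:ℝ), ∃ δ > (0:ℝ), ∀ s ∈ Set.Icc (0:ℝ) T,
    |s - t| < δ → blDist (m s) (m t) < ε) ∧
  m 0 = μ₀ ∧
  (∀ f : ℝ × ℝ → ℝ, ContDiff ℝ 1 f → HasCompactSupport f →
    (∫ x, f (x, T) ∂(m T)) - (∫ x, f (x, 0) ∂μ₀) =
      ∫ t in (0:ℝ)..T, ∫ x,
        (fderiv ℝ f (x, t) (0, 1) + V (m t) x * fderiv ℝ f (x, t) (1, 0)) ∂(m t))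

open scoped BoundedContinuousFunction NNReal

section BLDistance

variable {X : Type*} [PseudoMetricSpace X]

lemma IsBoundedLipschitz.abs_sub_le_dist {φ : X → ℝ} (hφ : IsBoundedLipschitz φ)
    (h1 : blNorm φ ≤ 1) (x y : X) : |φ x - φ y| ≤ dist x y := by
  obtain ⟨-, K, hK⟩ := hφ
  have hne : {K : ℝ | 0 ≤ K ∧ LipschitzWith K.toNNReal φ}.Nonempty :=
    ⟨K, K.coe_nonneg, by simpa using hK⟩
  have hinf : sInf {K : ℝ | 0 ≤ K ∧ LipschitzWith K.toNNReal φ} ≤ 1 := by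
    have : 0 ≤ ⨆ x, |φ x| := Real.iSup_nonneg fun _ ↦ abs_nonneg _
    unfold blNorm at h1
    linarith
  refine le_of_forall_pos_le_add fun ε hε ↦ ?_
  have hd : 0 < dist x y + 1 := by positivity
  obtain ⟨C, ⟨hC0, hC⟩, hlt⟩ := Real.lt_sInf_add_pos hne (div_pos hε hd)
  have hxy := hC.dist_le_mul x y
  rw [Real.coe_toNNReal _ hC0, Real.dist_eq] at hxy
  calc |φ x - φ y| ≤ C * dist x y := hxy
    _ ≤ (1 + ε / (dist x y + 1)) * dist x y := by gcongr; linarith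
    _ = dist x y + ε / (dist x y + 1) * dist x y := by ring
    _ ≤ dist x y + ε / (dist x y + 1) * (dist x y + 1) := by gcongr; linarith
    _ = dist x y + ε := by field_simp

lemma IsBoundedLipschitz.continuous {φ : X → ℝ} (hφ : IsBoundedLipschitz φ) : Continuous φ :=
  hφ.2.choose_spec.continuous

/-- The flat distance of two push-forwards of `μ` is controlled by the uniform distance of the
transport maps. -/
lemma blDist_map_le [MeasurableSpace X] [BorelSpace X] {Ω : Type*} [MeasurableSpace Ω]
    (μ : Measure Ω) [IsFiniteMeasure μ] {u v : Ω → X} (hu : Measurable u) (hv : Measurable v)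
    {C : ℝ} (hC : 0 ≤ C) (huv : ∀ ω, dist (u ω) (v ω) ≤ C) :
    blDist (μ.map u) (μ.map v) ≤ C * μ.real univ := by
  refine Real.sSup_le ?_ (by positivity)
  rintro r ⟨φ, hφ, h1, rfl⟩
  have hm := hφ.continuous.measurable
  obtain ⟨B, hB⟩ := hφ.1
  have hint {w : Ω → X} (hw : Measurable w) : Integrable (fun ω ↦ φ (w ω)) μ :=
    .of_bound (hm.comp hw).aestronglyMeasurable B (.of_forall fun _ ↦ hB _)
  rw [integral_map hu.aemeasurable hm.aestronglyMeasurable,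
    integral_map hv.aemeasurable hm.aestronglyMeasurable, ← integral_sub (hint hu) (hint hv)]
  rw [← Real.norm_eq_abs]
  refine norm_integral_le_of_norm_le_const (.of_forall fun ω ↦ ?_)
  exact (hφ.abs_sub_le_dist h1 _ _).trans (huv ω)

end BLDistance

/-- The push-forward of `μ` by the displacement `x ↦ x + d x`. -/
noncomputable def displaced (μ : Measure ℝ) (d : ℝ →ᵇ ℝ) : Measure ℝ :=
  μ.map fun x ↦ x + d x

lemma measurable_id_add (d : ℝ →ᵇ ℝ) : Measurable fun x ↦ x + d x := by
  fun_prop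

instance (μ : Measure ℝ) [IsFiniteMeasure μ] (d : ℝ →ᵇ ℝ) : IsFiniteMeasure (displaced μ d) := by
  unfold displaced; infer_instance

lemma integral_displaced (μ : Measure ℝ) (d : ℝ →ᵇ ℝ) {g : ℝ → ℝ} (hg : Continuous g) :
    ∫ x, g x ∂(displaced μ d) = ∫ x, g (x + d x) ∂μ :=
  integral_map (measurable_id_add d).aemeasurable hg.measurable.aestronglyMeasurable

lemma blDist_displaced_le (μ : Measure ℝ) [IsFiniteMeasure μ] (d e : ℝ →ᵇ ℝ) :
    blDist (displaced μ d) (displaced μ e) ≤ ‖d - e‖ * μ.real univ := by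
  refine blDist_map_le μ (measurable_id_add d) (measurable_id_add e) (norm_nonneg _) fun x ↦ ?_
  rw [dist_add_left, ← dist_eq_norm]
  exact BoundedContinuousFunction.dist_coe_le_dist x

/-- In Lagrangian coordinates, the transport equation becomes an ordinary differential equation
for the displacement, with a bounded Lipschitz vector field on bounded continuous functions. -/
lemma exists_lagrangian_field {Vmax L : ℝ} {V : Measure ℝ → ℝ → ℝ}
    (H1 : ∀ (μ : Measure ℝ), IsFiniteMeasure μ → ∀ x, 0 ≤ V μ x ∧ V μ x ≤ Vmax)
    (H2 : ∀ (μ : Measure ℝ), IsFiniteMeasure μ → ∀ x y, |V μ x - V μ y| ≤ L * |x - y|)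
    (H3 : ∀ (μ₁ μ₂ : Measure ℝ), IsFiniteMeasure μ₁ → IsFiniteMeasure μ₂ →
      ∀ x, |V μ₁ x - V μ₂ x| ≤ L * blDist μ₁ μ₂)
    (μ : Measure ℝ) [IsFiniteMeasure μ] :
    ∃ F : (ℝ →ᵇ ℝ) → (ℝ →ᵇ ℝ), (∀ d x, F d x = V (displaced μ d) (x + d x)) ∧
      (∀ d, ‖F d‖ ≤ Vmax) ∧ ∃ K, LipschitzWith K F := by
  have hL : 0 ≤ L := by
    have := (abs_nonneg _).trans (H2 0 inferInstance 0 1)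
    simpa using this
  have hVmax : 0 ≤ Vmax := (H1 0 inferInstance 0).1.trans (H1 0 inferInstance 0).2
  have hcont (ν : Measure ℝ) (hν : IsFiniteMeasure ν) : Continuous (V ν) :=
    (LipschitzWith.of_dist_le' fun x y ↦ H2 ν hν x y).continuous
  have hbound (d : ℝ →ᵇ ℝ) (x : ℝ) : ‖V (displaced μ d) (x + d x)‖ ≤ Vmax := by
    obtain ⟨h0, h1⟩ := H1 (displaced μ d) inferInstance (x + d x)
    rwa [Real.norm_of_nonneg h0]
  refine ⟨fun d ↦ .ofNormedAddCommGroup (fun x ↦ V (displaced μ d) (x + d x))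
    ((hcont _ inferInstance).comp (by fun_prop)) Vmax (hbound d), fun _ _ ↦ rfl,
    fun d ↦ BoundedContinuousFunction.norm_ofNormedAddCommGroup_le _ hVmax _,
    (L * μ.real univ + L).toNNReal, .of_dist_le_mul fun d e ↦ ?_⟩
  rw [Real.coe_toNNReal _ (by positivity), BoundedContinuousFunction.dist_le (by positivity)]
  intro x
  have h3 := H3 (displaced μ d) (displaced μ e) inferInstance inferInstance (x + d x)
  have h2 := H2 (displaced μ e) inferInstance (x + d x) (x + e x)
  have hde : |d x - e x| ≤ dist d e := by
    simpa only [Real.dist_eq] using BoundedContinuousFunction.dist_coe_le_dist (f := d) (g := e) x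
  have hbl := blDist_displaced_le μ d e
  rw [← dist_eq_norm] at hbl
  rw [add_sub_add_left_eq_sub] at h2
  calc |V (displaced μ d) (x + d x) - V (displaced μ e) (x + e x)|
      ≤ |V (displaced μ d) (x + d x) - V (displaced μ e) (x + d x)|
        + |V (displaced μ e) (x + d x) - V (displaced μ e) (x + e x)| := abs_sub_le _ _ _
    _ ≤ L * (dist d e * μ.real univ) + L * dist d e := by
      gcongr
      · exact h3.trans (by gcongr)
      · exact h2.trans (by gcongr)
    _ = (L * μ.real univ + L) * dist d e := by ring

/-- A bounded Lipschitz autonomous vector field has an integral curve on `[0, T]`. -/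
lemma exists_integral_curve {E : Type*} [NormedAddCommGroup E] [NormedSpace ℝ E] [CompleteSpace E]
    {F : E → E} {C : ℝ} {K : ℝ≥0} (hC : ∀ x, ‖F x‖ ≤ C) (hF : LipschitzWith K F) (x₀ : E)
    {T : ℝ} (hT : 0 ≤ T) :
    ∃ α : ℝ → E, Continuous α ∧ α 0 = x₀ ∧ ∀ t ∈ Ioo 0 T, HasDerivAt α (F (α t)) t := by
  have hC0 : 0 ≤ C := (norm_nonneg _).trans (hC x₀)
  have hpl : IsPicardLindelof (fun _ ↦ F) (⟨0, left_mem_Icc.2 hT⟩ : Icc 0 T) x₀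
      (C * T).toNNReal 0 C.toNNReal K := by
    refine .of_time_independent (fun x _ ↦ (hC x).trans (Real.le_coe_toNNReal C))
      hF.lipschitzOnWith ?_
    simp [hT, hC0, mul_nonneg]
  obtain ⟨α, h0, hα⟩ := hpl.exists_eq_forall_mem_Icc_hasDerivWithinAt₀
  have hcont : ContinuousOn α (Icc 0 T) := fun t ht ↦ (hα t ht).continuousWithinAt
  refine ⟨IccExtend hT ((Icc 0 T).domRestrict α), hcont.domRestrict.Icc_extend', ?_, fun t ht ↦ ?_⟩
  · rw [IccExtend_of_mem hT _ (left_mem_Icc.2 hT)]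
    exact h0
  · have heq : IccExtend hT ((Icc 0 T).domRestrict α) =ᶠ[nhds t] α := by
      filter_upwards [Icc_mem_nhds ht.1 ht.2] with s hs
      exact IccExtend_of_mem hT _ hs
    rw [heq.eq_of_nhds]
    exact ((hα t (Ioo_subset_Icc_self ht)).hasDerivAt (Icc_mem_nhds ht.1 ht.2)).congr_of_eventuallyEq
      heq

/-- The fundamental theorem of calculus along trajectories, integrated against `μ`. -/
lemma integral_displacement_sub (μ : Measure ℝ) [IsFiniteMeasure μ] {T : ℝ} (hT : 0 ≤ T)
    {α β : ℝ → ℝ →ᵇ ℝ} (hα : Continuous α) (hβ : Continuous β)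
    (hderiv : ∀ t ∈ Ioo 0 T, HasDerivAt α (β t) t) {C : ℝ} (hC : ∀ t, ‖β t‖ ≤ C)
    {f : ℝ × ℝ → ℝ} (hf : ContDiff ℝ 1 f) (hfc : HasCompactSupport f) :
    (∫ x, f (x + α T x, T) ∂μ) - ∫ x, f (x + α 0 x, 0) ∂μ =
      ∫ t in (0 : ℝ)..T, ∫ x, (fderiv ℝ f (x + α t x, t) (0, 1)
        + β t x * fderiv ℝ f (x + α t x, t) (1, 0)) ∂μ := by
  set g : ℝ → ℝ → ℝ := fun t x ↦ fderiv ℝ f (x + α t x, t) (0, 1)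
    + β t x * fderiv ℝ f (x + α t x, t) (1, 0) with hg
  have hf' := hf.continuous_fderiv one_ne_zero
  have hαx : Continuous fun p : ℝ × ℝ ↦ α p.1 p.2 :=
    (hα.comp continuous_fst).eval continuous_snd
  have hβx : Continuous fun p : ℝ × ℝ ↦ β p.1 p.2 :=
    (hβ.comp continuous_fst).eval continuous_snd
  have hgc : Continuous (Function.uncurry g) := by
    simp only [hg, Function.uncurry_def]
    fun_prop
  obtain ⟨B, hB⟩ := (hfc.fderiv ℝ).exists_bound_of_continuous hf'
  have hB0 : 0 ≤ B := (norm_nonneg _).trans (hB 0)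
  have hgb (p : ℝ × ℝ) : ‖Function.uncurry g p‖ ≤ B + C * B := by
    have hv (q v : ℝ × ℝ) (hv : ‖v‖ = 1) : ‖fderiv ℝ f q v‖ ≤ B := by
      simpa [hv] using (fderiv ℝ f q).le_of_opNorm_le (hB q) v
    have hβb : ‖β p.1 p.2‖ ≤ C := ((β p.1).norm_coe_le_norm p.2).trans (hC p.1)
    refine (norm_add_le _ _).trans (add_le_add (hv _ _ (by simp [Prod.norm_def])) ?_)
    rw [norm_mul]
    exact mul_le_mul hβb (hv _ _ (by simp [Prod.norm_def])) (norm_nonneg _)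
      ((norm_nonneg _).trans hβb)
  have : IsFiniteMeasure (volume.restrict (uIoc 0 T)) := by
    rw [uIoc_of_le hT]; infer_instance
  have hgi : Integrable (Function.uncurry g) ((volume.restrict (uIoc 0 T)).prod μ) :=
    .of_bound hgc.aestronglyMeasurable _ (.of_forall hgb)
  obtain ⟨B', hB'⟩ := hfc.exists_bound_of_continuous hf.continuous
  have hfi (t : ℝ) : Integrable (fun x ↦ f (x + α t x, t)) μ :=
    .of_bound (hf.continuous.comp (by fun_prop)).aestronglyMeasurable B' (.of_forall fun _ ↦ hB' _)
  rw [intervalIntegral_integral_swap hgi, ← integral_sub (hfi T) (hfi 0)]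
  refine integral_congr_ae (.of_forall fun x ↦ ?_)
  have hαt : Continuous fun t ↦ α t x := hα.eval_const x
  refine (intervalIntegral.integral_eq_sub_of_hasDerivAt_of_le hT
    (f := fun t ↦ f (x + α t x, t)) (hf.continuous.comp (by fun_prop)).continuousOn
    (fun t ht ↦ ?_) ?_).symm
  · have h1 : HasDerivAt (fun t ↦ α t x) (β t x) t :=
      (BoundedContinuousFunction.evalCLM ℝ x : (ℝ →ᵇ ℝ) →L[ℝ] ℝ).hasFDerivAt.comp_hasDerivAt t
        (hderiv t ht)
    have h2 := (hf.differentiable one_ne_zero (x + α t x, t)).hasFDerivAt.comp_hasDerivAt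
      (f := fun s ↦ (x + α s x, s)) t ((h1.const_add x).prodMk (hasDerivAt_id t))
    refine h2.congr_deriv ?_
    have hsplit : ((β t x, 1) : ℝ × ℝ) = (0, 1) + β t x • (1, 0) := by simp
    rw [hsplit, map_add, map_smul, smul_eq_mul]
  · exact (hgc.comp (by fun_prop : Continuous fun t : ℝ ↦ (t, x))).intervalIntegrable _ _

/-- Existence of a measure-valued solution of the nonlinear transport
equation ∂ₜ m + ∂ₓ(V(m_t) m) = 0 under (H1)–(H3), for initial data with finite first
and second moments. -/
theorem exists_mv_solution (T : ℝ) (hT : 0 < T) (Vmax L : ℝ)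
    (V : Measure ℝ → ℝ → ℝ)
    (H1 : ∀ (μ : Measure ℝ), IsFiniteMeasure μ → ∀ x, 0 ≤ V μ x ∧ V μ x ≤ Vmax)
    (H2 : ∀ (μ : Measure ℝ), IsFiniteMeasure μ → ∀ x y, |V μ x - V μ y| ≤ L * |x - y|)
    (H3 : ∀ (μ₁ μ₂ : Measure ℝ), IsFiniteMeasure μ₁ → IsFiniteMeasure μ₂ →
      ∀ x, |V μ₁ x - V μ₂ x| ≤ L * blDist μ₁ μ₂)
    (μ₀ : Measure ℝ) [IsFiniteMeasure μ₀]
    (hmom1 : ∫⁻ x, ENNReal.ofReal |x| ∂μ₀ < ⊤)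
    (hmom2 : ∫⁻ x, ENNReal.ofReal (|x| ^ 2) ∂μ₀ < ⊤) :
    ∃ m : ℝ → Measure ℝ, IsMVSolution T V μ₀ m := by
  obtain ⟨F, hFV, hFb, K, hFK⟩ := exists_lagrangian_field H1 H2 H3 μ₀
  obtain ⟨α, hα, hα0, hderiv⟩ := exists_integral_curve hFb hFK 0 hT.le
  have h0 : displaced μ₀ (α 0) = μ₀ := by simp [displaced, hα0]
  refine ⟨fun t ↦ displaced μ₀ (α t), fun t _ ↦ inferInstance, fun t _ ε hε ↦ ?_, h0,
    fun f hf hfc ↦ ?_⟩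
  · have hlim : Continuous fun s ↦ ‖α s - α t‖ * μ₀.real univ := by fun_prop
    obtain ⟨δ, hδ, h⟩ := Metric.continuousAt_iff.1 (hlim.continuousAt (x := t)) ε hε
    refine ⟨δ, hδ, fun s _ hs ↦ (blDist_displaced_le μ₀ _ _).trans_lt ?_⟩
    simpa using (le_abs_self _).trans_lt (h hs)
  · have hV (ν : Measure ℝ) (hν : IsFiniteMeasure ν) : Continuous (V ν) :=
      (LipschitzWith.of_dist_le' fun x y ↦ H2 ν hν x y).continuous
    have hf' := hf.continuous_fderiv one_ne_zero
    have key := integral_displacement_sub μ₀ hT.le hα (hFK.continuous.comp hα) hderiv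
      (fun t ↦ hFb (α t)) hf hfc
    have hfx (t : ℝ) : Continuous fun x ↦ f (x, t) := hf.continuous.comp (by fun_prop)
    nth_rw 2 [← h0]
    rw [integral_displaced _ _ (hfx T), integral_displaced _ _ (hfx 0), key]
    refine intervalIntegral.integral_congr fun t _ ↦ ?_
    have hVt := hV (displaced μ₀ (α t)) inferInstance
    simp only [Function.comp_apply, hFV]
    rw [integral_displaced _ _ (by fun_prop)]
end
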